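/- arXiv:2101.09024 — 2 statements merged into one kernel-verified Lean document; each statement's English description precedes it below -/
import Mathlib

section
/- For every valid online translation strategy σ and every integer m ≥ 1, there exists a stream L of n = m² + 1 pieces, each of whose two edge lengths is at least 1, such that ALG_σ(L) ≥ (m/2)·OPT(L), where the cost is the area of the bounding box. In particular, any competitive ratio of an online algorithm for area minimization with translations only, expressed as a function of the number n of pieces, is Ω(√n), even when all edges have length at least 1. -/
open Set

/-- A piece is a pair (w,h) of (intended positive) real numbers. -/
abbrev Piece := ℝ × ℝ

/-- Both edge lengths of the piece are positive. -/
def PiecePos (p : Piece) : Prop := 0 < p.1 ∧ 0 < p.2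

/-- The axis-parallel closed rectangle obtained by placing piece `p` by
translation at the point `q`. -/
def placedRect (p : Piece) (q : ℝ × ℝ) : Set (ℝ × ℝ) :=
  Set.Icc q.1 (q.1 + p.1) ×ˢ Set.Icc q.2 (q.2 + p.2)

/-- Width of the axis-parallel bounding box of a set in the plane. -/
noncomputable def boxWidth (S : Set (ℝ × ℝ)) : ℝ :=
  sSup (Prod.fst '' S) - sInf (Prod.fst '' S)

/-- Height of the axis-parallel bounding box of a set in the plane. -/
noncomputable def boxHeight (S : Set (ℝ × ℝ)) : ℝ :=
  sSup (Prod.snd '' S) - sInf (Prod.snd '' S)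

/-! ### Translations only -/

/-- `pos` is a packing (by translations) of the list `L` of pieces:
the placed rectangles have pairwise disjoint interiors. -/
def IsPacking (L : List Piece) (pos : Fin L.length → ℝ × ℝ) : Prop :=
  ∀ i j : Fin L.length, i ≠ j →
    Disjoint (interior (placedRect (L.get i) (pos i)))
             (interior (placedRect (L.get j) (pos j)))

/-- The union of the placed rectangles. -/
def packedSet (L : List Piece) (pos : Fin L.length → ℝ × ℝ) : Set (ℝ × ℝ) :=
  ⋃ i : Fin L.length, placedRect (L.get i) (pos i)

/-- Perimeter of the bounding box of a packing. -/
noncomputable def periCost (L : List Piece) (pos : Fin L.length → ℝ × ℝ) : ℝ :=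
  2 * (boxWidth (packedSet L pos) + boxHeight (packedSet L pos))

/-- Area of the bounding box of a packing. -/
noncomputable def areaCost (L : List Piece) (pos : Fin L.length → ℝ × ℝ) : ℝ :=
  boxWidth (packedSet L pos) * boxHeight (packedSet L pos)

/-- Optimal offline bounding-box perimeter for the pieces of `L`. -/
noncomputable def optPeri (L : List Piece) : ℝ :=
  sInf { c | ∃ pos : Fin L.length → ℝ × ℝ, IsPacking L pos ∧ periCost L pos = c }

/-- Optimal offline bounding-box area for the pieces of `L`. -/
noncomputable def optArea (L : List Piece) : ℝ :=
  sInf { c | ∃ pos : Fin L.length → ℝ × ℝ, IsPacking L pos ∧ areaCost L pos = c }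

/-- The positions chosen by the online strategy `σ` on the stream `L`:
the `i`-th piece is placed at the point chosen by `σ` as a function of the
first `i+1` pieces. -/
def onlinePos (σ : List Piece → ℝ × ℝ) (L : List Piece) :
    Fin L.length → ℝ × ℝ :=
  fun i => σ (L.take ((i : ℕ) + 1))

/-- `σ` is a valid online translation strategy: on every stream of pieces it
produces a packing. -/
def StrategyValid (σ : List Piece → ℝ × ℝ) : Prop :=
  ∀ L : List Piece, (∀ p ∈ L, PiecePos p) → IsPacking L (onlinePos σ L)

/-- Perimeter of the bounding box of the packing produced by `σ` on `L`. -/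
noncomputable def algPeri (σ : List Piece → ℝ × ℝ) (L : List Piece) : ℝ :=
  periCost L (onlinePos σ L)

/-- Area of the bounding box of the packing produced by `σ` on `L`. -/
noncomputable def algArea (σ : List Piece → ℝ × ℝ) (L : List Piece) : ℝ :=
  areaCost L (onlinePos σ L)

/-! ### Rotations by 90° allowed -/

/-- The piece `p` in the orientation given by `r`: rotated by 90° if `r` is
`true`. -/
def orient (p : Piece) (r : Bool) : Piece := if r then (p.2, p.1) else p

/-- `pos, rot` is a packing with rotations of the list `L` of pieces. -/
def IsRotPacking (L : List Piece) (pos : Fin L.length → ℝ × ℝ)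
    (rot : Fin L.length → Bool) : Prop :=
  ∀ i j : Fin L.length, i ≠ j →
    Disjoint (interior (placedRect (orient (L.get i) (rot i)) (pos i)))
             (interior (placedRect (orient (L.get j) (rot j)) (pos j)))

/-- The union of the placed (possibly rotated) rectangles. -/
def packedRotSet (L : List Piece) (pos : Fin L.length → ℝ × ℝ)
    (rot : Fin L.length → Bool) : Set (ℝ × ℝ) :=
  ⋃ i : Fin L.length, placedRect (orient (L.get i) (rot i)) (pos i)

/-- Perimeter of the bounding box of a packing with rotations. -/
noncomputable def periRotCost (L : List Piece) (pos : Fin L.length → ℝ × ℝ)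
    (rot : Fin L.length → Bool) : ℝ :=
  2 * (boxWidth (packedRotSet L pos rot) + boxHeight (packedRotSet L pos rot))

/-- Area of the bounding box of a packing with rotations. -/
noncomputable def areaRotCost (L : List Piece) (pos : Fin L.length → ℝ × ℝ)
    (rot : Fin L.length → Bool) : ℝ :=
  boxWidth (packedRotSet L pos rot) * boxHeight (packedRotSet L pos rot)

/-- Optimal offline bounding-box perimeter with rotations allowed. -/
noncomputable def optRotPeri (L : List Piece) : ℝ :=
  sInf { c | ∃ (pos : Fin L.length → ℝ × ℝ) (rot : Fin L.length → Bool),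
    IsRotPacking L pos rot ∧ periRotCost L pos rot = c }

/-- Optimal offline bounding-box area with rotations allowed. -/
noncomputable def optRotArea (L : List Piece) : ℝ :=
  sInf { c | ∃ (pos : Fin L.length → ℝ × ℝ) (rot : Fin L.length → Bool),
    IsRotPacking L pos rot ∧ areaRotCost L pos rot = c }

/-- The positions chosen by the online rotation strategy `σ` on the stream `L`. -/
def onlineRotPos (σ : List Piece → (ℝ × ℝ) × Bool) (L : List Piece) :
    Fin L.length → ℝ × ℝ :=
  fun i => (σ (L.take ((i : ℕ) + 1))).1

/-- The orientations chosen by the online rotation strategy `σ` on the stream `L`. -/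
def onlineRot (σ : List Piece → (ℝ × ℝ) × Bool) (L : List Piece) :
    Fin L.length → Bool :=
  fun i => (σ (L.take ((i : ℕ) + 1))).2

/-- `σ` is a valid online rotation strategy: on every stream of pieces it
produces a packing with rotations. -/
def RotStrategyValid (σ : List Piece → (ℝ × ℝ) × Bool) : Prop :=
  ∀ L : List Piece, (∀ p ∈ L, PiecePos p) →
    IsRotPacking L (onlineRotPos σ L) (onlineRot σ L)

/-- Perimeter of the bounding box of the packing produced by `σ` on `L`. -/
noncomputable def algRotPeri (σ : List Piece → (ℝ × ℝ) × Bool) (L : List Piece) : ℝ :=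
  periRotCost L (onlineRotPos σ L) (onlineRot σ L)

/-- Area of the bounding box of the packing produced by `σ` on `L`. -/
noncomputable def algRotArea (σ : List Piece → (ℝ × ℝ) × Bool) (L : List Piece) : ℝ :=
  areaRotCost L (onlineRotPos σ L) (onlineRot σ L)

/-! ### Square pieces, bounding-square cost -/

/-- The axis-parallel closed square of side `s` placed at the point `q`. -/
def placedSq (s : ℝ) (q : ℝ × ℝ) : Set (ℝ × ℝ) :=
  Set.Icc q.1 (q.1 + s) ×ˢ Set.Icc q.2 (q.2 + s)

/-- `pos` is a packing of the list `L` of square pieces. -/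
def IsSqPacking (L : List ℝ) (pos : Fin L.length → ℝ × ℝ) : Prop :=
  ∀ i j : Fin L.length, i ≠ j →
    Disjoint (interior (placedSq (L.get i) (pos i)))
             (interior (placedSq (L.get j) (pos j)))

/-- The union of the placed squares. -/
def packedSqSet (L : List ℝ) (pos : Fin L.length → ℝ × ℝ) : Set (ℝ × ℝ) :=
  ⋃ i : Fin L.length, placedSq (L.get i) (pos i)

/-- Area of the smallest axis-parallel square containing all placed squares. -/
noncomputable def sqCost (L : List ℝ) (pos : Fin L.length → ℝ × ℝ) : ℝ :=
  (max (boxWidth (packedSqSet L pos)) (boxHeight (packedSqSet L pos))) ^ 2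

/-- Optimal offline bounding-square area for the square pieces of `L`. -/
noncomputable def optSq (L : List ℝ) : ℝ :=
  sInf { c | ∃ pos : Fin L.length → ℝ × ℝ, IsSqPacking L pos ∧ sqCost L pos = c }

/-- The positions chosen by the online strategy `σ` on the stream `L` of
square pieces. -/
def onlineSqPos (σ : List ℝ → ℝ × ℝ) (L : List ℝ) : Fin L.length → ℝ × ℝ :=
  fun i => σ (L.take ((i : ℕ) + 1))

/-- `σ` is a valid online translation strategy for square pieces. -/
def SqStrategyValid (σ : List ℝ → ℝ × ℝ) : Prop :=
  ∀ L : List ℝ, (∀ s ∈ L, 0 < s) → IsSqPacking L (onlineSqPos σ L)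

/-- Bounding-square area of the packing produced by `σ` on `L`. -/
noncomputable def algSq (σ : List ℝ → ℝ × ℝ) (L : List ℝ) : ℝ :=
  sqCost L (onlineSqPos σ L)

lemma isBounded_packedSet (L : List Piece) (pos : Fin L.length → ℝ × ℝ) :
    Bornology.IsBounded (packedSet L pos) :=
  (isCompact_iUnion fun _ => isCompact_Icc.prod isCompact_Icc).isBounded

lemma sub_le_boxWidth {S : Set (ℝ × ℝ)} (hS : Bornology.IsBounded S) {p q : ℝ × ℝ}
    (hp : p ∈ S) (hq : q ∈ S) : q.1 - p.1 ≤ boxWidth S :=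
  sub_le_sub (le_csSup hS.image_fst.bddAbove (mem_image_of_mem _ hq))
    (csInf_le hS.image_fst.bddBelow (mem_image_of_mem _ hp))

lemma sub_le_boxHeight {S : Set (ℝ × ℝ)} (hS : Bornology.IsBounded S) {p q : ℝ × ℝ}
    (hp : p ∈ S) (hq : q ∈ S) : q.2 - p.2 ≤ boxHeight S :=
  sub_le_sub (le_csSup hS.image_snd.bddAbove (mem_image_of_mem _ hq))
    (csInf_le hS.image_snd.bddBelow (mem_image_of_mem _ hp))

lemma boxWidth_nonneg {S : Set (ℝ × ℝ)} (hS : Bornology.IsBounded S) : 0 ≤ boxWidth S := by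
  rcases S.eq_empty_or_nonempty with rfl | ⟨p, hp⟩
  · simp [boxWidth]
  · simpa using sub_le_boxWidth hS hp hp

lemma boxHeight_nonneg {S : Set (ℝ × ℝ)} (hS : Bornology.IsBounded S) : 0 ≤ boxHeight S := by
  rcases S.eq_empty_or_nonempty with rfl | ⟨p, hp⟩
  · simp [boxHeight]
  · simpa using sub_le_boxHeight hS hp hp

lemma boxWidth_le {S : Set (ℝ × ℝ)} {a b : ℝ} (hab : a ≤ b)
    (h : ∀ p ∈ S, p.1 ∈ Icc a b) : boxWidth S ≤ b - a := by
  rcases S.eq_empty_or_nonempty with rfl | hS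
  · simpa [boxWidth] using hab
  · exact sub_le_sub
      (csSup_le (hS.image _) (by rintro _ ⟨p, hp, rfl⟩; exact (h p hp).2))
      (le_csInf (hS.image _) (by rintro _ ⟨p, hp, rfl⟩; exact (h p hp).1))

lemma boxHeight_le {S : Set (ℝ × ℝ)} {a b : ℝ} (hab : a ≤ b)
    (h : ∀ p ∈ S, p.2 ∈ Icc a b) : boxHeight S ≤ b - a := by
  rcases S.eq_empty_or_nonempty with rfl | hS
  · simpa [boxHeight] using hab
  · exact sub_le_sub
      (csSup_le (hS.image _) (by rintro _ ⟨p, hp, rfl⟩; exact (h p hp).2))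
      (le_csInf (hS.image _) (by rintro _ ⟨p, hp, rfl⟩; exact (h p hp).1))

lemma lowerLeft_mem_packedSet {L : List Piece} {pos : Fin L.length → ℝ × ℝ}
    {i : Fin L.length} (hi : PiecePos (L.get i)) : pos i ∈ packedSet L pos :=
  mem_iUnion.2 ⟨i, ⟨le_rfl, by linarith [hi.1]⟩, le_rfl, by linarith [hi.2]⟩

lemma upperRight_mem_packedSet {L : List Piece} {pos : Fin L.length → ℝ × ℝ}
    {i : Fin L.length} (hi : PiecePos (L.get i)) : pos i + L.get i ∈ packedSet L pos :=
  mem_iUnion.2 ⟨i, ⟨by simpa using hi.1.le, le_rfl⟩, by simpa using hi.2.le, le_rfl⟩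

lemma optArea_le {L : List Piece} {pos : Fin L.length → ℝ × ℝ} (h : IsPacking L pos) :
    optArea L ≤ areaCost L pos := by
  refine csInf_le ⟨0, ?_⟩ ⟨pos, h, rfl⟩
  rintro _ ⟨q, -, rfl⟩
  exact mul_nonneg (boxWidth_nonneg (isBounded_packedSet L q))
    (boxHeight_nonneg (isBounded_packedSet L q))

lemma interior_placedRect (p : Piece) (q : ℝ × ℝ) :
    interior (placedRect p q) = Ioo q.1 (q.1 + p.1) ×ˢ Ioo q.2 (q.2 + p.2) := by
  rw [placedRect, interior_prod_eq, interior_Icc, interior_Icc]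

lemma not_disjoint_interior_unitSquares {p q : ℝ × ℝ} (h₁ : |p.1 - q.1| < 1)
    (h₂ : |p.2 - q.2| < 1) :
    ¬ Disjoint (interior (placedRect (1, 1) p)) (interior (placedRect (1, 1) q)) := by
  rw [abs_lt] at h₁ h₂
  rw [Set.not_disjoint_iff]
  refine ⟨((p.1 + q.1 + 1) / 2, (p.2 + q.2 + 1) / 2), ?_, ?_⟩ <;>
    simp only [interior_placedRect, mem_prod, mem_Ioo] <;>
    refine ⟨⟨?_, ?_⟩, ?_, ?_⟩ <;> linarith

lemma abs_sub_lt_one_of_natFloor_eq {a b c : ℝ} (ha : c ≤ a) (hb : c ≤ b)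
    (h : ⌊a - c⌋₊ = ⌊b - c⌋₊) : |a - b| < 1 := by
  have h1 := Nat.floor_le (sub_nonneg.2 ha)
  have h2 := Nat.floor_le (sub_nonneg.2 hb)
  have h3 := Nat.lt_floor_add_one (a - c)
  have h4 := Nat.lt_floor_add_one (b - c)
  rw [h] at h1 h3
  rw [abs_lt]
  constructor <;> linarith

/-- Among `m ^ 2` interior-disjoint unit squares, two have corners at distance at least `m - 1`
in one of the coordinate directions. -/
lemma exists_spread_of_disjoint_unitSquares {m : ℕ} (hm : 1 ≤ m) (x : Fin (m ^ 2) → ℝ × ℝ)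
    (hx : ∀ i j, i ≠ j →
      Disjoint (interior (placedRect (1, 1) (x i))) (interior (placedRect (1, 1) (x j)))) :
    (∃ i j, (m : ℝ) - 1 ≤ (x j).1 - (x i).1) ∨ ∃ i j, (m : ℝ) - 1 ≤ (x j).2 - (x i).2 := by
  by_contra! ⟨hw, hh⟩
  have : Nonempty (Fin (m ^ 2)) := ⟨⟨0, by positivity⟩⟩
  obtain ⟨a, ha⟩ := Finite.exists_min fun i => (x i).1
  obtain ⟨b, hb⟩ := Finite.exists_min fun i => (x i).2
  have hcast : ((m - 1 : ℕ) : ℝ) = m - 1 := by push_cast [hm]; rfl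
  obtain ⟨i, -, j, -, hij, he⟩ := Finset.exists_ne_map_eq_of_card_lt_of_maps_to
    (s := Finset.univ) (t := Finset.range (m - 1) ×ˢ Finset.range (m - 1))
    (f := fun i => (⌊(x i).1 - (x a).1⌋₊, ⌊(x i).2 - (x b).2⌋₊))
    (by
      rw [Finset.card_product, Finset.card_range, Finset.card_univ, Fintype.card_fin, sq]
      exact Nat.mul_self_lt_mul_self (by omega))
    (by
      intro i _
      simp only [Finset.coe_product, Finset.coe_range, mem_prod, mem_Iio]
      rw [Nat.floor_lt (sub_nonneg.2 (ha i)), Nat.floor_lt (sub_nonneg.2 (hb i)), hcast]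
      exact ⟨hw a i, hh b i⟩)
  rw [Prod.mk.injEq] at he
  exact not_disjoint_interior_unitSquares
    (abs_sub_lt_one_of_natFloor_eq (ha i) (ha j) he.1)
    (abs_sub_lt_one_of_natFloor_eq (hb i) (hb j) he.2) (hx i j hij)

/-- `k` unit squares followed by the piece `p`. -/
def unitSquaresThen (k : ℕ) (p : Piece) : List Piece := List.replicate k (1, 1) ++ [p]

lemma length_unitSquaresThen (k : ℕ) (p : Piece) : (unitSquaresThen k p).length = k + 1 := by
  simp [unitSquaresThen]

lemma get_unitSquaresThen_of_lt {k : ℕ} {p : Piece} (i : Fin (unitSquaresThen k p).length)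
    (hi : (i : ℕ) < k) : (unitSquaresThen k p).get i = (1, 1) := by
  rw [List.get_eq_getElem]
  simp [unitSquaresThen, hi]

lemma get_unitSquaresThen_of_not_lt {k : ℕ} {p : Piece}
    (i : Fin (unitSquaresThen k p).length) (hi : ¬ (i : ℕ) < k) :
    (unitSquaresThen k p).get i = p := by
  rw [List.get_eq_getElem]
  simp [unitSquaresThen, List.getElem_append, hi]

lemma onlinePos_unitSquaresThen (σ : List Piece → ℝ × ℝ) {k : ℕ} {p : Piece}
    (i : Fin (unitSquaresThen k p).length) (hi : (i : ℕ) < k) :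
    onlinePos σ (unitSquaresThen k p) i = σ (List.replicate (i + 1) (1, 1)) := by
  have h1 : i + 1 - k = 0 := by omega
  have h2 : min (i + 1 : ℕ) k = i + 1 := by omega
  simp [onlinePos, unitSquaresThen, List.take_append, List.take_replicate, h1, h2]

lemma optArea_unitSquaresThen_vertical_le {k : ℕ} (hk : 1 ≤ k) :
    optArea (unitSquaresThen k (1, (k : ℝ))) ≤ 2 * k := by
  have hk' : (1 : ℝ) ≤ k := by exact_mod_cast hk
  set L := unitSquaresThen k (1, (k : ℝ))
  have hlen : L.length = k + 1 := length_unitSquaresThen _ _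
  let pos : Fin L.length → ℝ × ℝ := fun i => (0, (i : ℕ))
  have hlt : ∀ i j : Fin L.length, i < j →
      Disjoint (interior (placedRect (L.get i) (pos i)))
        (interior (placedRect (L.get j) (pos j))) := by
    intro i j hij
    rw [Set.disjoint_left]
    intro q hqi hqj
    rw [get_unitSquaresThen_of_lt i (by have := j.2; omega)] at hqi
    rw [interior_placedRect] at hqi hqj
    have h1 : q.2 < (i : ℕ) + 1 := hqi.2.2
    have h2 : ((j : ℕ) : ℝ) < q.2 := hqj.2.1
    have h3 : ((i : ℕ) : ℝ) + 1 ≤ (j : ℕ) := by exact_mod_cast hij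
    linarith
  have hpack : IsPacking L pos := fun i j hij =>
    hij.lt_or_gt.elim (hlt i j) fun h => (hlt j i h).symm
  have hmem : ∀ q ∈ packedSet L pos, q.1 ∈ Icc (0 : ℝ) 1 ∧ q.2 ∈ Icc (0 : ℝ) (2 * k) := by
    intro q hq
    obtain ⟨i, ⟨h1, h2⟩, h3, h4⟩ := mem_iUnion.1 hq
    have hi0 : (0 : ℝ) ≤ (i : ℕ) := by positivity
    have hik : ((i : ℕ) : ℝ) ≤ k := by have := i.2; exact_mod_cast (by omega : (i : ℕ) ≤ k)
    by_cases hi : (i : ℕ) < k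
    · rw [get_unitSquaresThen_of_lt i hi] at h2 h4
      simp only [pos] at h1 h2 h3 h4
      exact ⟨⟨h1, by linarith⟩, by linarith, by linarith⟩
    · rw [get_unitSquaresThen_of_not_lt i hi] at h2 h4
      simp only [pos] at h1 h2 h3 h4
      exact ⟨⟨h1, by linarith⟩, by linarith, by linarith⟩
  refine (optArea_le hpack).trans ?_
  have hw := boxWidth_le zero_le_one fun q hq => (hmem q hq).1
  have hh := boxHeight_le (by positivity) fun q hq => (hmem q hq).2
  have := mul_le_mul hw hh (boxHeight_nonneg (isBounded_packedSet L pos)) (by norm_num)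
  simpa [areaCost] using this

lemma optArea_unitSquaresThen_horizontal_le {k : ℕ} (hk : 1 ≤ k) :
    optArea (unitSquaresThen k ((k : ℝ), 1)) ≤ 2 * k := by
  have hk' : (1 : ℝ) ≤ k := by exact_mod_cast hk
  set L := unitSquaresThen k ((k : ℝ), 1)
  have hlen : L.length = k + 1 := length_unitSquaresThen _ _
  let pos : Fin L.length → ℝ × ℝ := fun i => ((i : ℕ), 0)
  have hlt : ∀ i j : Fin L.length, i < j →
      Disjoint (interior (placedRect (L.get i) (pos i)))
        (interior (placedRect (L.get j) (pos j))) := by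
    intro i j hij
    rw [Set.disjoint_left]
    intro q hqi hqj
    rw [get_unitSquaresThen_of_lt i (by have := j.2; omega)] at hqi
    rw [interior_placedRect] at hqi hqj
    have h1 : q.1 < (i : ℕ) + 1 := hqi.1.2
    have h2 : ((j : ℕ) : ℝ) < q.1 := hqj.1.1
    have h3 : ((i : ℕ) : ℝ) + 1 ≤ (j : ℕ) := by exact_mod_cast hij
    linarith
  have hpack : IsPacking L pos := fun i j hij =>
    hij.lt_or_gt.elim (hlt i j) fun h => (hlt j i h).symm
  have hmem : ∀ q ∈ packedSet L pos, q.1 ∈ Icc (0 : ℝ) (2 * k) ∧ q.2 ∈ Icc (0 : ℝ) 1 := by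
    intro q hq
    obtain ⟨i, ⟨h1, h2⟩, h3, h4⟩ := mem_iUnion.1 hq
    have hi0 : (0 : ℝ) ≤ (i : ℕ) := by positivity
    have hik : ((i : ℕ) : ℝ) ≤ k := by have := i.2; exact_mod_cast (by omega : (i : ℕ) ≤ k)
    by_cases hi : (i : ℕ) < k
    · rw [get_unitSquaresThen_of_lt i hi] at h2 h4
      simp only [pos] at h1 h2 h3 h4
      exact ⟨⟨by linarith, by linarith⟩, by linarith, by linarith⟩
    · rw [get_unitSquaresThen_of_not_lt i hi] at h2 h4
      simp only [pos] at h1 h2 h3 h4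
      exact ⟨⟨by linarith, by linarith⟩, by linarith, by linarith⟩
  refine (optArea_le hpack).trans ?_
  have hw := boxWidth_le (by positivity) fun q hq => (hmem q hq).1
  have hh := boxHeight_le zero_le_one fun q hq => (hmem q hq).2
  have := mul_le_mul hw hh (boxHeight_nonneg (isBounded_packedSet L pos)) (by linarith)
  simpa [areaCost] using this

/-- The box of the final packing spans the first squares as well as the last piece. -/
lemma boxWidth_boxHeight_unitSquaresThen (σ : List Piece → ℝ × ℝ) {k : ℕ} {p : Piece}
    (hp : PiecePos p) :
    let S := packedSet (unitSquaresThen k p) (onlinePos σ (unitSquaresThen k p))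
    let x : Fin k → ℝ × ℝ := fun i => σ (List.replicate (i + 1) (1, 1))
    p.1 ≤ boxWidth S ∧ p.2 ≤ boxHeight S ∧
      (∀ i j, (x j).1 - (x i).1 + 1 ≤ boxWidth S) ∧
      ∀ i j, (x j).2 - (x i).2 + 1 ≤ boxHeight S := by
  intro S x
  have hS : Bornology.IsBounded S := isBounded_packedSet _ _
  have hlen := length_unitSquaresThen k p
  have hlast := get_unitSquaresThen_of_not_lt (p := p) ⟨k, by omega⟩ (lt_irrefl k)
  have hl := lowerLeft_mem_packedSet (pos := onlinePos σ (unitSquaresThen k p))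
    (hlast ▸ hp)
  have hu := upperRight_mem_packedSet (pos := onlinePos σ (unitSquaresThen k p))
    (hlast ▸ hp)
  have hx : ∀ i, x i ∈ S ∧ x i + (1, 1) ∈ S := by
    intro i
    have hg := get_unitSquaresThen_of_lt (p := p) ⟨i, by omega⟩ i.2
    have ho := onlinePos_unitSquaresThen σ (p := p) ⟨i, by omega⟩ i.2
    have hpos : PiecePos ((unitSquaresThen k p).get ⟨i, by omega⟩) := by
      rw [hg]; exact ⟨one_pos, one_pos⟩
    have h1 := lowerLeft_mem_packedSet (pos := onlinePos σ (unitSquaresThen k p)) hpos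
    have h2 := upperRight_mem_packedSet (pos := onlinePos σ (unitSquaresThen k p)) hpos
    rw [ho] at h1 h2
    rw [hg] at h2
    exact ⟨h1, h2⟩
  rw [hlast] at hu
  refine ⟨?_, ?_, fun i j => ?_, fun i j => ?_⟩
  · simpa using sub_le_boxWidth hS hl hu
  · simpa using sub_le_boxHeight hS hl hu
  · have := sub_le_boxWidth hS (hx i).1 (hx j).2
    simp only [Prod.fst_add] at this
    linarith
  · have := sub_le_boxHeight hS (hx i).1 (hx j).2
    simp only [Prod.snd_add] at this
    linarith

lemma one_le_of_mem_unitSquaresThen {k : ℕ} {p : Piece} (hp : 1 ≤ p.1 ∧ 1 ≤ p.2) :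
    ∀ q ∈ unitSquaresThen k p, 1 ≤ q.1 ∧ 1 ≤ q.2 := by
  intro q hq
  rcases List.mem_append.1 hq with h | h
  · rw [List.eq_of_mem_replicate h]
    exact ⟨le_rfl, le_rfl⟩
  · rwa [List.mem_singleton.1 h]

lemma StrategyValid.disjoint_unitSquares {σ : List Piece → ℝ × ℝ} (hσ : StrategyValid σ)
    {k : ℕ} (i j : Fin k) (hij : i ≠ j) :
    Disjoint (interior (placedRect (1, 1) (σ (List.replicate (i + 1) (1, 1)))))
      (interior (placedRect (1, 1) (σ (List.replicate (j + 1) (1, 1))))) := by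
  have hpos : ∀ p ∈ List.replicate k ((1, 1) : Piece), PiecePos p := by
    intro p hp
    rw [List.eq_of_mem_replicate hp]
    exact ⟨one_pos, one_pos⟩
  have h := hσ _ hpos ⟨i, by simp⟩ ⟨j, by simp⟩ (by simpa [Fin.ext_iff] using hij)
  have hi : min (i + 1 : ℕ) k = i + 1 := by omega
  have hj : min (j + 1 : ℕ) k = j + 1 := by omega
  simpa [onlinePos, List.take_replicate, hi, hj] using h

/-- For every valid online translation strategy `σ` and every
integer `m ≥ 1`, there exists a stream `L` of `m² + 1` pieces, each with both
edge lengths at least 1, such that `ALG_σ(L) ≥ (m/2) * OPT(L)` (area of the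
bounding box). -/
theorem area_translation_sqrt_n_lower_bound
    (σ : List Piece → ℝ × ℝ) (hσ : StrategyValid σ) (m : ℕ) (hm : 1 ≤ m) :
    ∃ L : List Piece, L.length = m ^ 2 + 1 ∧ (∀ q ∈ L, 1 ≤ q.1 ∧ 1 ≤ q.2) ∧
      ((m : ℝ) / 2) * optArea L ≤ algArea σ L := by
  have hk : 1 ≤ m ^ 2 := Nat.one_le_pow _ _ hm
  have hk' : (1 : ℝ) ≤ ((m ^ 2 : ℕ) : ℝ) := by exact_mod_cast hk
  have hm0 : (0 : ℝ) ≤ m := by positivity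
  rcases exists_spread_of_disjoint_unitSquares hm
      (fun i => σ (List.replicate (i + 1) (1, 1))) hσ.disjoint_unitSquares with
    ⟨i, j, hij⟩ | ⟨i, j, hij⟩
  · refine ⟨unitSquaresThen (m ^ 2) (1, ((m ^ 2 : ℕ) : ℝ)), length_unitSquaresThen _ _,
      one_le_of_mem_unitSquaresThen ⟨le_rfl, hk'⟩, ?_⟩
    obtain ⟨-, hh, hw, -⟩ := boxWidth_boxHeight_unitSquaresThen σ (k := m ^ 2)
      (p := (1, ((m ^ 2 : ℕ) : ℝ))) ⟨one_pos, by positivity⟩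
    calc (m : ℝ) / 2 * optArea _ ≤ m / 2 * (2 * (m ^ 2 : ℕ)) := by
          gcongr
          exact optArea_unitSquaresThen_vertical_le hk
      _ = m * (m ^ 2 : ℕ) := by ring
      _ ≤ _ := mul_le_mul (by linarith [hw i j]) hh (by positivity)
          (boxWidth_nonneg (isBounded_packedSet _ _))
  · refine ⟨unitSquaresThen (m ^ 2) (((m ^ 2 : ℕ) : ℝ), 1), length_unitSquaresThen _ _,
      one_le_of_mem_unitSquaresThen ⟨hk', le_rfl⟩, ?_⟩
    obtain ⟨hw, -, -, hh⟩ := boxWidth_boxHeight_unitSquaresThen σ (k := m ^ 2)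
      (p := (((m ^ 2 : ℕ) : ℝ), 1)) ⟨by positivity, one_pos⟩
    calc (m : ℝ) / 2 * optArea _ ≤ m / 2 * (2 * (m ^ 2 : ℕ)) := by
          gcongr
          exact optArea_unitSquaresThen_horizontal_le hk
      _ = (m ^ 2 : ℕ) * m := by ring
      _ ≤ _ := mul_le_mul hw (by linarith [hh i j]) hm0
          (boxWidth_nonneg (isBounded_packedSet _ _))
end

section
/- For every valid online rotation strategy σ and every integer m ≥ 1, there exists a stream L of n = m² + 1 pieces, each of whose two edge lengths is at least 1, such that ALG_σ(L) ≥ (m/2)·OPT(L), where the cost is the area of the bounding box. In particular, any competitive ratio of an online algorithm for area minimization with rotations allowed, expressed as a function of the number n of pieces, is Ω(√n), even when all edges have length at least 1. -/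
open Set

theorem isCompact_placedRect (p : Piece) (q : ℝ × ℝ) : IsCompact (placedRect p q) :=
  isCompact_Icc.prod isCompact_Icc

theorem mem_placedRect_self {p : Piece} (hp : PiecePos p) (q : ℝ × ℝ) : q ∈ placedRect p q :=
  ⟨⟨le_rfl, by linarith [hp.1]⟩, ⟨le_rfl, by linarith [hp.2]⟩⟩

theorem mem_placedRect_add {p : Piece} (hp : PiecePos p) (q : ℝ × ℝ) :
    q + p ∈ placedRect p q :=
  ⟨⟨by simpa using hp.1.le, le_rfl⟩, ⟨by simpa using hp.2.le, le_rfl⟩⟩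

theorem PiecePos.orient {p : Piece} (hp : PiecePos p) (r : Bool) : PiecePos (orient p r) := by
  cases r
  · exact hp
  · exact ⟨hp.2, hp.1⟩

theorem orient_area (p : Piece) (r : Bool) : (orient p r).1 * (orient p r).2 = p.1 * p.2 := by
  cases r
  · rfl
  · exact mul_comm _ _

theorem volume_interior_placedRect {p : Piece} (hp : PiecePos p) (q : ℝ × ℝ) :
    MeasureTheory.volume (interior (placedRect p q)) = ENNReal.ofReal (p.1 * p.2) := by
  rw [placedRect, interior_prod_eq, interior_Icc, interior_Icc,
    MeasureTheory.Measure.volume_eq_prod, MeasureTheory.Measure.prod_prod, Real.volume_Ioo,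
    Real.volume_Ioo, add_sub_cancel_left, add_sub_cancel_left, ENNReal.ofReal_mul hp.1.le]

theorem disjoint_interior_placedRect {p p' : Piece} {q q' : ℝ × ℝ}
    (h : q.1 + p.1 ≤ q'.1 ∨ q.2 + p.2 ≤ q'.2) :
    Disjoint (interior (placedRect p q)) (interior (placedRect p' q')) := by
  simp only [placedRect, interior_prod_eq, interior_Icc]
  rw [Set.disjoint_left]
  rintro x ⟨⟨_, h1⟩, _, h2⟩ ⟨⟨h3, _⟩, h4, _⟩
  rcases h with h | h <;> linarith

/-! ### Bounding boxes -/

theorem boxWidth_nonneg_s9 {T : Set (ℝ × ℝ)} (hT : IsCompact T) : 0 ≤ boxWidth T := by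
  have hc := hT.image continuous_fst
  exact sub_nonneg.2 (Real.sInf_le_sSup _ hc.bddBelow hc.bddAbove)

theorem boxHeight_nonneg_s9 {T : Set (ℝ × ℝ)} (hT : IsCompact T) : 0 ≤ boxHeight T := by
  have hc := hT.image continuous_snd
  exact sub_nonneg.2 (Real.sInf_le_sSup _ hc.bddBelow hc.bddAbove)

theorem boxWidth_mono {S T : Set (ℝ × ℝ)} (hT : IsCompact T) (hS : S.Nonempty) (h : S ⊆ T) :
    boxWidth S ≤ boxWidth T := by
  have hc := hT.image continuous_fst
  exact sub_le_sub (csSup_le_csSup hc.bddAbove (hS.image _) (image_mono h))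
    (csInf_le_csInf hc.bddBelow (hS.image _) (image_mono h))

theorem boxHeight_mono {S T : Set (ℝ × ℝ)} (hT : IsCompact T) (hS : S.Nonempty) (h : S ⊆ T) :
    boxHeight S ≤ boxHeight T := by
  have hc := hT.image continuous_snd
  exact sub_le_sub (csSup_le_csSup hc.bddAbove (hS.image _) (image_mono h))
    (csInf_le_csInf hc.bddBelow (hS.image _) (image_mono h))

theorem le_boxWidth {T : Set (ℝ × ℝ)} (hT : IsCompact T) {p : Piece} (hp : PiecePos p)
    {q : ℝ × ℝ} (h : placedRect p q ⊆ T) : p.1 ≤ boxWidth T := by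
  have hc := hT.image continuous_fst
  have h1 := csInf_le hc.bddBelow (mem_image_of_mem Prod.fst (h (mem_placedRect_self hp q)))
  have h2 := le_csSup hc.bddAbove (mem_image_of_mem Prod.fst (h (mem_placedRect_add hp q)))
  rw [Prod.fst_add] at h2
  unfold boxWidth
  linarith

theorem le_boxHeight {T : Set (ℝ × ℝ)} (hT : IsCompact T) {p : Piece} (hp : PiecePos p)
    {q : ℝ × ℝ} (h : placedRect p q ⊆ T) : p.2 ≤ boxHeight T := by
  have hc := hT.image continuous_snd
  have h1 := csInf_le hc.bddBelow (mem_image_of_mem Prod.snd (h (mem_placedRect_self hp q)))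
  have h2 := le_csSup hc.bddAbove (mem_image_of_mem Prod.snd (h (mem_placedRect_add hp q)))
  rw [Prod.snd_add] at h2
  unfold boxHeight
  linarith

/-- A set is covered by its bounding box, so its area is at most that of the box. -/
theorem volume_le_box {T : Set (ℝ × ℝ)} (hT : IsCompact T) :
    MeasureTheory.volume T ≤ ENNReal.ofReal (boxWidth T * boxHeight T) := by
  have hc := hT.image continuous_fst
  have hd := hT.image continuous_snd
  have hsub : T ⊆ Icc (sInf (Prod.fst '' T)) (sSup (Prod.fst '' T)) ×ˢ
      Icc (sInf (Prod.snd '' T)) (sSup (Prod.snd '' T)) := fun x hx =>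
    ⟨⟨csInf_le hc.bddBelow (mem_image_of_mem _ hx), le_csSup hc.bddAbove (mem_image_of_mem _ hx)⟩,
      ⟨csInf_le hd.bddBelow (mem_image_of_mem _ hx), le_csSup hd.bddAbove (mem_image_of_mem _ hx)⟩⟩
  refine (MeasureTheory.measure_mono hsub).trans ?_
  rw [MeasureTheory.Measure.volume_eq_prod, MeasureTheory.Measure.prod_prod, Real.volume_Icc,
    Real.volume_Icc, ENNReal.ofReal_mul (boxWidth_nonneg_s9 hT)]
  rfl

/-! ### Packings with rotations -/

theorem isCompact_packedRotSet (L : List Piece) (pos : Fin L.length → ℝ × ℝ)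
    (rot : Fin L.length → Bool) : IsCompact (packedRotSet L pos rot) :=
  isCompact_iUnion fun _ => isCompact_placedRect _ _

theorem areaRotCost_nonneg (L : List Piece) (pos : Fin L.length → ℝ × ℝ)
    (rot : Fin L.length → Bool) : 0 ≤ areaRotCost L pos rot :=
  mul_nonneg (boxWidth_nonneg_s9 (isCompact_packedRotSet L pos rot))
    (boxHeight_nonneg_s9 (isCompact_packedRotSet L pos rot))

theorem IsRotPacking.sum_area_le {L : List Piece} {pos : Fin L.length → ℝ × ℝ}
    {rot : Fin L.length → Bool} (h : IsRotPacking L pos rot) (hL : ∀ p ∈ L, PiecePos p) :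
    ∑ i, (L.get i).1 * (L.get i).2 ≤ areaRotCost L pos rot := by
  have hpos : ∀ i, PiecePos (L.get i) := fun i => hL _ (L.get_mem i)
  rw [← ENNReal.ofReal_le_ofReal_iff (areaRotCost_nonneg L pos rot),
    ENNReal.ofReal_sum_of_nonneg fun i _ => mul_nonneg (hpos i).1.le (hpos i).2.le]
  calc ∑ i, ENNReal.ofReal ((L.get i).1 * (L.get i).2)
      = ∑ i, MeasureTheory.volume (interior (placedRect (orient (L.get i) (rot i)) (pos i))) :=
        Finset.sum_congr rfl fun i _ => by
          rw [volume_interior_placedRect ((hpos i).orient _), orient_area]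
    _ = MeasureTheory.volume
          (⋃ i, interior (placedRect (orient (L.get i) (rot i)) (pos i))) := by
        rw [MeasureTheory.measure_iUnion (fun i j hij => h i j hij)
          fun i => isOpen_interior.measurableSet, tsum_fintype]
    _ ≤ MeasureTheory.volume (packedRotSet L pos rot) :=
        MeasureTheory.measure_mono (iUnion_mono fun _ => interior_subset)
    _ ≤ ENNReal.ofReal (areaRotCost L pos rot) := volume_le_box (isCompact_packedRotSet L pos rot)

/-- A family of pairwise separated unrotated placements inside `[0, A] × [0, B]` bounds the
optimal area by `A * B`. -/
theorem optRotArea_le {L : List Piece} (hne : L ≠ []) (hL : ∀ p ∈ L, PiecePos p)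
    (pos : Fin L.length → ℝ × ℝ) {A B : ℝ}
    (hsep : ∀ i j, i < j → (pos i).1 + (L.get i).1 ≤ (pos j).1 ∨
      (pos i).2 + (L.get i).2 ≤ (pos j).2)
    (hlo : ∀ i, 0 ≤ (pos i).1 ∧ 0 ≤ (pos i).2)
    (hhi : ∀ i, (pos i).1 + (L.get i).1 ≤ A ∧ (pos i).2 + (L.get i).2 ≤ B) :
    optRotArea L ≤ A * B := by
  have hpack : IsRotPacking L pos fun _ => false := by
    intro i j hij
    rcases lt_or_gt_of_ne hij with h | h
    · exact disjoint_interior_placedRect (hsep i j h)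
    · exact (disjoint_interior_placedRect (hsep j i h)).symm
  have hsub : packedRotSet L pos (fun _ => false) ⊆ Icc 0 A ×ˢ Icc 0 B := by
    refine iUnion_subset fun i => ?_
    exact prod_mono (Icc_subset_Icc (hlo i).1 (hhi i).1) (Icc_subset_Icc (hlo i).2 (hhi i).2)
  let i₀ : Fin L.length := ⟨0, List.length_pos_iff.2 hne⟩
  have hnon : (packedRotSet L pos fun _ => false).Nonempty :=
    ⟨pos i₀, mem_iUnion.2 ⟨i₀, mem_placedRect_self (hL _ (L.get_mem i₀)) _⟩⟩
  have hbox : IsCompact (Icc 0 A ×ˢ Icc 0 B : Set (ℝ × ℝ)) := isCompact_Icc.prod isCompact_Icc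
  obtain ⟨x, ⟨hx1, hx2⟩, hx3, hx4⟩ := hnon.mono hsub
  have hA : 0 ≤ A := hx1.trans hx2
  have hB : 0 ≤ B := hx3.trans hx4
  have hA' : boxWidth (Icc 0 A ×ˢ Icc 0 B) = A := by
    rw [boxWidth, fst_image_prod _ (nonempty_Icc.2 hB), csSup_Icc hA, csInf_Icc hA, sub_zero]
  have hB' : boxHeight (Icc 0 A ×ˢ Icc 0 B) = B := by
    rw [boxHeight, snd_image_prod (nonempty_Icc.2 hA), csSup_Icc hB, csInf_Icc hB, sub_zero]
  have hw := (boxWidth_mono hbox hnon hsub).trans_eq hA'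
  have hh := (boxHeight_mono hbox hnon hsub).trans_eq hB'
  refine le_trans (csInf_le ⟨0, ?_⟩ ⟨pos, fun _ => false, hpack, rfl⟩)
    (mul_le_mul hw hh (boxHeight_nonneg_s9 (isCompact_packedRotSet _ _ _)) hA)
  rintro c ⟨pos', rot', -, rfl⟩
  exact areaRotCost_nonneg _ _ _

/-! ### Online strategies -/

/-- The packing produced on a stream contains the one produced on any prefix of it. -/
theorem packedRotSet_online_append_subset (σ : List Piece → (ℝ × ℝ) × Bool) (L L' : List Piece) :
    packedRotSet L (onlineRotPos σ L) (onlineRot σ L) ⊆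
      packedRotSet (L ++ L') (onlineRotPos σ (L ++ L')) (onlineRot σ (L ++ L')) := by
  refine iUnion_subset fun i => ?_
  have hi := i.2
  refine subset_iUnion_of_subset ⟨i, by simp; omega⟩ ?_
  have ht : (L ++ L').take ((i : ℕ) + 1) = L.take ((i : ℕ) + 1) :=
    List.take_append_of_le_length hi
  simp [onlineRotPos, onlineRot, ht]

/-- Appending a piece `q` to the stream `L` makes one side of the box at least as long as the first
edge of `q` and the other at least as long as its second edge, while both sides are still at least
those of the box produced on `L`. -/
theorem algRotArea_append_singleton (σ : List Piece → (ℝ × ℝ) × Bool) {L : List Piece} {q : Piece}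
    (hne : L ≠ []) (hL : ∀ p ∈ L, PiecePos p) (hq : PiecePos q) :
    ∃ W H, boxWidth (packedRotSet L (onlineRotPos σ L) (onlineRot σ L)) ≤ W ∧
      boxHeight (packedRotSet L (onlineRotPos σ L) (onlineRot σ L)) ≤ H ∧
      (q.1 ≤ W ∧ q.2 ≤ H ∨ q.2 ≤ W ∧ q.1 ≤ H) ∧ algRotArea σ (L ++ [q]) = W * H := by
  have hc := isCompact_packedRotSet (L ++ [q]) (onlineRotPos σ (L ++ [q])) (onlineRot σ (L ++ [q]))
  have hsub := packedRotSet_online_append_subset σ L [q]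
  let i₀ : Fin L.length := ⟨0, List.length_pos_iff.2 hne⟩
  have hnon : (packedRotSet L (onlineRotPos σ L) (onlineRot σ L)).Nonempty :=
    ⟨_, mem_iUnion.2 ⟨i₀, mem_placedRect_self ((hL _ (L.get_mem i₀)).orient _) _⟩⟩
  refine ⟨_, _, boxWidth_mono hc hnon hsub, boxHeight_mono hc hnon hsub, ?_, rfl⟩
  let k : Fin (L ++ [q]).length := ⟨L.length, by simp⟩
  have hk : (L ++ [q]).get k = q := by simp [k]
  have hrect : placedRect (orient q (onlineRot σ (L ++ [q]) k)) (onlineRotPos σ (L ++ [q]) k) ⊆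
      packedRotSet (L ++ [q]) (onlineRotPos σ (L ++ [q])) (onlineRot σ (L ++ [q])) := by
    refine subset_iUnion_of_subset k ?_
    rw [hk]
  have hw := le_boxWidth hc (hq.orient _) hrect
  have hh := le_boxHeight hc (hq.orient _) hrect
  cases hr : onlineRot σ (L ++ [q]) k <;> rw [hr] at hw hh
  · exact Or.inl ⟨hw, hh⟩
  · exact Or.inr ⟨hw, hh⟩

/-! ### The adversarial streams -/

/-- `k` strips of length `s` laid end to end next to one strip of length `k * s`. -/
theorem optRotArea_strips_append_strip {k : ℕ} (hk : 0 < k) {s : ℝ} (hs : 0 < s) :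
    optRotArea (List.replicate k (s, 1) ++ [(k * s, 1)]) ≤ k * s * 2 := by
  have hk' : (0 : ℝ) < k := by exact_mod_cast hk
  refine optRotArea_le (by simp) ?_
    (fun i => if (i : ℕ) < k then ((i : ℕ) * s, 0) else (0, 1)) ?_ ?_ ?_
  · simp only [List.mem_append, List.mem_replicate, List.mem_singleton]
    rintro p (⟨-, rfl⟩ | rfl)
    · exact ⟨hs, one_pos⟩
    · exact ⟨by positivity, one_pos⟩
  · rintro ⟨i, hi⟩ ⟨j, hj⟩ hij
    simp only [List.length_append, List.length_replicate, List.length_singleton] at hi hj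
    rw [Fin.mk_lt_mk] at hij
    have hik : i < k := by omega
    by_cases hjk : j < k
    · have : (i : ℝ) + 1 ≤ j := by exact_mod_cast hij
      left
      simp [hik, hjk]
      nlinarith
    · right
      simp [hik, hjk]
  · rintro ⟨i, hi⟩
    dsimp only
    split_ifs
    · exact ⟨by positivity, le_rfl⟩
    · exact ⟨le_rfl, zero_le_one⟩
  · rintro ⟨i, hi⟩
    by_cases hik : i < k
    · have : (i : ℝ) + 1 ≤ k := by exact_mod_cast hik
      simp [hik]
      nlinarith
    · simp [hik, List.getElem_append]
      norm_num

/-- `k` strips of length `k` stacked to a square next to one square of side `k`. -/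
theorem optRotArea_strips_append_square {k : ℕ} (hk : 0 < k) :
    optRotArea (List.replicate k ((k : ℝ), 1) ++ [((k : ℝ), (k : ℝ))]) ≤ k * (k + k) := by
  have hk' : (0 : ℝ) < k := by exact_mod_cast hk
  refine optRotArea_le (by simp) ?_ (fun i => (0, (i : ℕ))) ?_ ?_ ?_
  · simp only [List.mem_append, List.mem_replicate, List.mem_singleton]
    rintro p (⟨-, rfl⟩ | rfl)
    · exact ⟨hk', one_pos⟩
    · exact ⟨hk', hk'⟩
  · rintro ⟨i, hi⟩ ⟨j, hj⟩ hij
    simp only [List.length_append, List.length_replicate, List.length_singleton] at hi hj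
    rw [Fin.mk_lt_mk] at hij
    have hik : i < k := by omega
    right
    simp [hik]
    exact_mod_cast hij
  · exact fun i => ⟨le_rfl, Nat.cast_nonneg _⟩
  · rintro ⟨i, hi⟩
    simp only [List.length_append, List.length_replicate, List.length_singleton] at hi
    by_cases hik : i < k
    · have : (i : ℝ) + 1 ≤ k := by exact_mod_cast hik
      simp [hik]
      linarith
    · obtain rfl : i = k := by omega
      simp

/-- For every valid online rotation strategy `σ` and every
integer `m ≥ 1`, there exists a stream `L` of `m² + 1` pieces, each with both
edge lengths at least 1, such that `ALG_σ(L) ≥ (m/2) * OPT(L)` (area of the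
bounding box, rotations by 90° allowed). -/
theorem area_rotation_sqrt_n_lower_bound
    (σ : List Piece → (ℝ × ℝ) × Bool) (hσ : RotStrategyValid σ)
    (m : ℕ) (hm : 1 ≤ m) :
    ∃ L : List Piece, L.length = m ^ 2 + 1 ∧ (∀ q ∈ L, 1 ≤ q.1 ∧ 1 ≤ q.2) ∧
      ((m : ℝ) / 2) * optRotArea L ≤ algRotArea σ L := by
  set k := m ^ 2 with hk
  have hk0 : 0 < k := by positivity
  have hm1 : (1 : ℝ) ≤ m := by exact_mod_cast hm
  have hkm : (k : ℝ) = m * m := by rw [hk]; push_cast; ring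
  have hk1 : (1 : ℝ) ≤ k := by exact_mod_cast hk0
  set L := List.replicate k ((k : ℝ), (1 : ℝ)) with hLdef
  have hne : L ≠ [] := by simp [hLdef, hk0.ne']
  have hge : ∀ p ∈ L, 1 ≤ p.1 ∧ 1 ≤ p.2 := fun p hp => by
    rw [List.eq_of_mem_replicate hp]
    exact ⟨hk1, le_rfl⟩
  have hL : ∀ p ∈ L, PiecePos p := fun p hp =>
    ⟨one_pos.trans_le (hge p hp).1, one_pos.trans_le (hge p hp).2⟩
  have harea : (k : ℝ) * k ≤ algRotArea σ L := by
    refine le_trans (le_of_eq ?_) (IsRotPacking.sum_area_le (hσ L hL) hL)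
    simp [hLdef]
  change _ ≤ boxWidth (packedRotSet L (onlineRotPos σ L) (onlineRot σ L)) *
    boxHeight (packedRotSet L (onlineRotPos σ L) (onlineRot σ L)) at harea
  have hb := boxHeight_nonneg_s9 (isCompact_packedRotSet L (onlineRotPos σ L) (onlineRot σ L))
  have ha := boxWidth_nonneg_s9 (isCompact_packedRotSet L (onlineRotPos σ L) (onlineRot σ L))
  have key : ∀ q : Piece, 1 ≤ q.1 → 1 ≤ q.2 →
      (m : ℝ) / 2 * optRotArea (L ++ [q]) ≤ algRotArea σ (L ++ [q]) →
      ∃ L : List Piece, L.length = k + 1 ∧ (∀ q ∈ L, 1 ≤ q.1 ∧ 1 ≤ q.2) ∧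
        ((m : ℝ) / 2) * optRotArea L ≤ algRotArea σ L := by
    intro q h1 h2 h
    refine ⟨L ++ [q], by simp [hLdef], fun p hp => ?_, h⟩
    rcases List.mem_append.1 hp with hp | hp
    · exact hge p hp
    · rw [List.mem_singleton.1 hp]
      exact ⟨h1, h2⟩
  generalize hA : boxWidth (packedRotSet L (onlineRotPos σ L) (onlineRot σ L)) = a at *
  generalize hB : boxHeight (packedRotSet L (onlineRotPos σ L) (onlineRot σ L)) = b at *
  by_cases hmin : (m : ℝ) ≤ a ∧ (m : ℝ) ≤ b
  · have hkk : (1 : ℝ) ≤ k * k := one_le_mul_of_one_le_of_one_le hk1 hk1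
    refine key (k * k, 1) hkk le_rfl ?_
    have hopt := optRotArea_strips_append_strip hk0 (one_pos.trans_le hk1)
    obtain ⟨W, H, hW, hH, hq, heq⟩ :=
      algRotArea_append_singleton σ (q := (k * k, 1)) hne hL ⟨one_pos.trans_le hkk, one_pos⟩
    rw [hA] at hW
    rw [hB] at hH
    rw [heq]
    have hle : (m : ℝ) * (k * k) ≤ W * H := by
      rcases hq with ⟨hq, -⟩ | ⟨-, hq⟩
      · rw [mul_comm]
        exact mul_le_mul hq (hmin.2.trans hH) (by positivity) (by linarith)
      · exact mul_le_mul (hmin.1.trans hW) hq (by positivity) (by linarith)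
    have := mul_le_mul_of_nonneg_left hopt (show (0 : ℝ) ≤ m / 2 by positivity)
    linarith
  · refine key (k, k) hk1 hk1 ?_
    have hopt := optRotArea_strips_append_square hk0
    obtain ⟨W, H, hW, hH, hq, heq⟩ :=
      algRotArea_append_singleton σ (q := (k, k)) hne hL ⟨one_pos.trans_le hk1, one_pos.trans_le hk1⟩
    rw [hA] at hW
    rw [hB] at hH
    rw [heq]
    have hq' : (k : ℝ) ≤ W ∧ (k : ℝ) ≤ H := by simpa using hq
    have hle : (m : ℝ) * k * k ≤ W * H := by
      have hsq : (k : ℝ) * k = m * (m * k) := by rw [hkm]; ring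
      rcases not_and_or.1 hmin with h | h
      · have : (m : ℝ) * k ≤ H := by
          refine le_trans ?_ hH
          refine le_of_mul_le_mul_left ?_ (one_pos.trans_le hm1)
          rw [← hsq]
          exact harea.trans (mul_le_mul_of_nonneg_right (not_le.1 h).le hb)
        rw [mul_comm W]
        exact mul_le_mul this hq'.1 (by positivity) (by linarith)
      · have : (m : ℝ) * k ≤ W := by
          refine le_trans ?_ hW
          refine le_of_mul_le_mul_right ?_ (one_pos.trans_le hm1)
          rw [mul_comm _ (m : ℝ), ← hsq]
          exact harea.trans (mul_le_mul_of_nonneg_left (not_le.1 h).le ha)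
        exact mul_le_mul this hq'.2 (by positivity) (by linarith)
    have := mul_le_mul_of_nonneg_left hopt (show (0 : ℝ) ≤ m / 2 by positivity)
    linarith
end
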